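/- Let A be a finite set of points in R^m with at least two distinct points. Then the pyramidal width PWidth(A) := min over faces F of conv(A) and over pairs u ≠ v in F of PdirW(F∩A, v−u, u) equals Φ(A), the minimum over pairs u ≠ v in conv(A) of PdirW(A, v−u, u). -/

import Mathlib

open scoped RealInnerProductSpace

/-- Pyramidal directional width `PdirW(A, r, u)`. -/
noncomputable def pdirW {m : ℕ} (A : Set (EuclideanSpace ℝ (Fin m)))
    (r u : EuclideanSpace ℝ (Fin m)) : ℝ :=
  sInf {t | ∃ S : Set (EuclideanSpace ℝ (Fin m)), S ⊆ A ∧ u ∈ convexHull ℝ S ∧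
    t = sSup {c | ∃ a ∈ A, ∃ s ∈ S, c = ⟪(‖r‖)⁻¹ • r, a - s⟫}}

section aux
variable {V : Type*} [NormedAddCommGroup V] [InnerProductSpace ℝ V]

lemma aux_split {T U : Set V} {z : V} (hz : z ∈ convexHull ℝ (T ∪ U)) :
    z ∈ convexHull ℝ T ∨ z ∈ convexHull ℝ U ∨
      ∃ x ∈ convexHull ℝ T, ∃ y ∈ convexHull ℝ U, z ∈ openSegment ℝ x y := by
  rcases T.eq_empty_or_nonempty with rfl | hT
  · right; left; simpa using hz
  rcases U.eq_empty_or_nonempty with rfl | hU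
  · left; simpa using hz
  rw [convexHull_union hT hU, mem_convexJoin] at hz
  obtain ⟨x, hx, y, hy, h⟩ := hz
  rw [← insert_endpoints_openSegment] at h
  rcases h with rfl | rfl | h
  · exact Or.inl hx
  · exact Or.inr (Or.inl hy)
  · exact Or.inr (Or.inr ⟨x, hx, y, hy, h⟩)

lemma aux_diff {A E : Set V} (hE : IsExtreme ℝ (convexHull ℝ A) E) :
    convexHull ℝ (A \ E) ⊆ convexHull ℝ A \ E :=
  convexHull_min (fun a ha => ⟨subset_convexHull ℝ A ha.1, ha.2⟩)
    (hE.convex_sdiff (convex_convexHull ℝ A))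

lemma aux_ext {A E : Set V} (hE : IsExtreme ℝ (convexHull ℝ A) E) :
    E ⊆ convexHull ℝ (A ∩ E) := by
  intro z hz
  have h := hE.subset hz
  rw [← Set.inter_union_sdiff A E] at h
  rcases aux_split h with h | h | ⟨x, hx, y, hy, h⟩
  · exact h
  · exact absurd hz (aux_diff hE h).2
  · exact absurd (hE.right_mem_of_mem_openSegment
      (convexHull_mono Set.inter_subset_left hx) (aux_diff hE hy).1 hz h) (aux_diff hE hy).2

lemma aux_max {T : Set V} (l : V →L[ℝ] ℝ) {y : V} (hy : y ∈ convexHull ℝ T)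
    (hl : ∀ a ∈ T, l a ≤ l y) : y ∈ convexHull ℝ {a ∈ T | l a = l y} := by
  have hl' : ∀ a ∈ convexHull ℝ T, l a ≤ l y := by
    have : convexHull ℝ T ⊆ {a | l a ≤ l y} :=
      convexHull_min hl (convex_halfSpace_le l.toLinearMap.isLinear _)
    exact this
  have hE : IsExposed ℝ (convexHull ℝ T) (l.toExposed (convexHull ℝ T)) :=
    ContinuousLinearMap.toExposed.isExposed
  have := aux_ext hE.isExtreme (show y ∈ l.toExposed (convexHull ℝ T) from ⟨hy, hl'⟩)
  refine convexHull_mono ?_ this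
  rintro a ⟨ha, ha'⟩
  exact ⟨ha, le_antisymm (hl a ha) (ha'.2 y hy)⟩

lemma aux_near {K : Set V} (hK : Convex ℝ K) {u v : V} (hv : v ∈ K)
    (h : ∀ w ∈ K, ‖u - v‖ ≤ ‖u - w‖) : ∀ w ∈ K, ⟪u - v, w - v⟫ ≤ 0 := by
  rw [← norm_eq_iInf_iff_real_inner_le_zero hK hv]
  haveI : Nonempty K := ⟨⟨v, hv⟩⟩
  refine le_antisymm (le_ciInf fun w => h w w.2) ?_
  exact ciInf_le ⟨0, by rintro _ ⟨w, rfl⟩; positivity⟩ (⟨v, hv⟩ : K)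

/-- minimal face -/
def auxM (C : Set V) (p : V) : Set V := {z ∈ C | ∃ z' ∈ C, p ∈ openSegment ℝ z z'}

lemma auxM_extreme {C : Set V} (hC : Convex ℝ C) (p : V) : IsExtreme ℝ C (auxM C p) := by
  refine ⟨fun z hz => hz.1, ?_⟩
  rintro x hx y hy z ⟨hz, z', hz', e, f, he, hf, hef, rfl⟩ ⟨a, b, ha, hb, hab, rfl⟩
  have h1 : 0 < e * b + f := by positivity
  refine ⟨hx, ((e * b) / (e * b + f)) • y + (f / (e * b + f)) • z', ?_, e * a, e * b + f,
    by positivity, h1, ?_, ?_⟩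
  · exact hC hy hz' (by positivity) (by positivity) (by field_simp)
  · rw [← add_assoc, ← mul_add, hab, mul_one, hef]
  · match_scalars <;> field_simp

lemma auxM_convex {C : Set V} (hC : Convex ℝ C) (p : V) : Convex ℝ (auxM C p) := by
  rw [convex_iff_forall_pos]
  rintro z₁ ⟨hz₁, w₁, hw₁, e₁, f₁, he₁, hf₁, h₁, k₁⟩ z₂ ⟨hz₂, w₂, hw₂, e₂, f₂, he₂, hf₂, h₂, k₂⟩
    a b ha hb hab
  refine ⟨hC hz₁ hz₂ ha.le hb.le hab, ?_⟩
  have hD : 0 < a * e₂ + b * e₁ := by positivity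
  have hN : 0 < a * e₂ * f₁ + b * e₁ * f₂ := by positivity
  refine ⟨((a * e₂ * f₁) / (a * e₂ * f₁ + b * e₁ * f₂)) • w₁ +
    ((b * e₁ * f₂) / (a * e₂ * f₁ + b * e₁ * f₂)) • w₂,
    hC hw₁ hw₂ (by positivity) (by positivity) (by field_simp),
    e₁ * e₂ / (a * e₂ + b * e₁), (a * e₂ * f₁ + b * e₁ * f₂) / (a * e₂ + b * e₁),
    by positivity, by positivity, ?_, ?_⟩
  · rw [← add_div, div_eq_one_iff_eq hD.ne']
    obtain rfl : f₁ = 1 - e₁ := by linarith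
    obtain rfl : f₂ = 1 - e₂ := by linarith
    obtain rfl : b = 1 - a := by linarith
    ring
  · have : p = ((a * e₂) / (a * e₂ + b * e₁)) • p + ((b * e₁) / (a * e₂ + b * e₁)) • p := by
      rw [← add_smul, ← add_div, div_self hD.ne', one_smul]
    rw [this]
    nth_rewrite 1 [← k₁]
    rw [← k₂]
    match_scalars <;> field_simp

lemma auxM_mem {C : Set V} {p : V} (hp : p ∈ C) : p ∈ auxM C p :=
  ⟨hp, p, hp, by simp⟩

/-- The max-ray argument. -/
lemma aux_ray {A F S : Set V} (hA : A.Finite) (hF : IsExtreme ℝ (convexHull ℝ A) F)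
    (hFc : Convex ℝ F) (hFcl : IsCompact F) (hS : S ⊆ F ∩ A) {u v : V}
    (hu : u ∈ convexHull ℝ S) (hv : v ∈ F) (huv : u ≠ v) :
    ∃ E, IsExtreme ℝ (convexHull ℝ A) E ∧ Convex ℝ E ∧ ∃ p ∈ F, p ∈ E ∧ ∃ q ∈ convexHull ℝ S,
      q ∈ convexHull ℝ (A \ E) ∧ ∃ t : ℝ, 0 ≤ t ∧ p - q = t • (v - u) := by
  have hSF : convexHull ℝ S ⊆ F := convexHull_min (fun s hs => (hS hs).1) hFc
  set r := v - u with hr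
  have hr0 : 0 < ⟪r, r⟫ := by
    rw [real_inner_self_eq_norm_sq]
    have : 0 < ‖r‖ := norm_pos_iff.2 (sub_ne_zero.2 huv.symm)
    positivity
  let K : Set (V × V) := (F ×ˢ convexHull ℝ S) ∩ {x | ⟪r, r⟫ • (x.1 - x.2) = ⟪r, x.1 - x.2⟫ • r}
  have hSfin : S.Finite := hA.subset (hS.trans Set.inter_subset_right)
  have hK : IsCompact K := by
    refine (hFcl.prod (hSfin.isCompact_convexHull ℝ)).inter_right (isClosed_eq ?_ ?_) <;> fun_prop
  have hvu : (v, u) ∈ K := ⟨⟨hv, hu⟩, rfl⟩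
  obtain ⟨⟨p, q⟩, ⟨⟨hp, hq⟩, hpq⟩, hmax⟩ := hK.exists_isMaxOn ⟨_, hvu⟩
    (f := fun x : V × V => ⟪r, x.1 - x.2⟫) (by fun_prop)
  have hmax' : ∀ p' ∈ F, ∀ q' ∈ convexHull ℝ S, ⟪r, r⟫ • (p' - q') = ⟪r, p' - q'⟫ • r →
      ⟪r, p' - q'⟫ ≤ ⟪r, p - q⟫ := fun p' hp' q' hq' h => hmax (⟨⟨hp', hq'⟩, h⟩ : (p', q') ∈ K)
  have hpos : 0 < ⟪r, p - q⟫ := hr0.trans_le (hmax' v hv u hu rfl)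
  simp only [Set.mem_ofPred_eq] at hpq
  have hC := convex_convexHull ℝ A
  have key : ∀ x ∈ auxM (convexHull ℝ A) p, x ∈ convexHull ℝ S → ∀ y ∈ convexHull ℝ S,
      q ∉ openSegment ℝ x y := by
    rintro x ⟨hx, z, hz, hpz⟩ hxS y hy ⟨a, b, ha, hb, hab, k⟩
    have hzF := hF.right_mem_of_mem_openSegment hx hz hp hpz
    obtain ⟨e, f, he, hf, hef, k'⟩ := hpz
    -- remove d of x
    obtain ⟨d, hd, hda, hde⟩ : ∃ d : ℝ, 0 < d ∧ d < a ∧ d < e := by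
      obtain ⟨d, h1, h2⟩ := exists_between (lt_min ha he)
      exact ⟨d, h1, h2.trans_le (min_le_left _ _), h2.trans_le (min_le_right _ _)⟩
    have hd1 : 0 < 1 - d := by linarith
    have e1 : ((e - d) / (1 - d)) • x + (f / (1 - d)) • z = (1 - d)⁻¹ • (p - d • x) := by
      rw [← k']; match_scalars <;> field_simp
    have e2 : ((a - d) / (1 - d)) • x + (b / (1 - d)) • y = (1 - d)⁻¹ • (q - d • x) := by
      rw [← k]; match_scalars <;> field_simp
    have m1 : (1 - d)⁻¹ • (p - d • x) ∈ F := by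
      rw [← e1]
      exact hFc (hSF hxS) hzF (div_nonneg (by linarith) hd1.le) (by positivity)
        (by rw [← add_div, div_eq_one_iff_eq hd1.ne']; linarith)
    have m2 : (1 - d)⁻¹ • (q - d • x) ∈ convexHull ℝ S := by
      rw [← e2]
      exact convex_convexHull ℝ S hxS hy (div_nonneg (by linarith) hd1.le) (by positivity)
        (by rw [← add_div, div_eq_one_iff_eq hd1.ne']; linarith)
    have e3 : (1 - d)⁻¹ • (p - d • x) - (1 - d)⁻¹ • (q - d • x) = (1 - d)⁻¹ • (p - q) := by
      module
    have := hmax' _ m1 _ m2 (by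
      rw [e3, inner_smul_right, smul_comm, hpq, smul_smul])
    rw [e3, inner_smul_right] at this
    have h1 : 1 < (1 - d)⁻¹ := (one_lt_inv₀ hd1).2 (by linarith)
    nlinarith
  refine ⟨auxM (convexHull ℝ A) p, auxM_extreme hC p, auxM_convex hC p, p, hp,
    auxM_mem (hF.subset hp), q, hq, ?_, ⟪r, p - q⟫ / ⟪r, r⟫, by positivity, ?_⟩
  · have hq' := hq
    rw [← Set.inter_union_sdiff S (auxM (convexHull ℝ A) p)] at hq'
    have hM : convexHull ℝ (S ∩ auxM (convexHull ℝ A) p) ⊆ auxM (convexHull ℝ A) p :=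
      convexHull_min Set.inter_subset_right (auxM_convex hC p)
    rcases aux_split hq' with h | h | ⟨x, hx, y, hy, h⟩
    · exact absurd (by simp) (key q (hM h) hq q hq)
    · have hsub : S \ auxM (convexHull ℝ A) p ⊆ A \ auxM (convexHull ℝ A) p :=
        fun s hs => ⟨(hS hs.1).2, hs.2⟩
      exact convexHull_mono hsub h
    · exact absurd h (key x (hM hx) (convexHull_mono Set.inter_subset_left hx) y
        (convexHull_mono Set.sdiff_subset hy))
  · rw [div_eq_inv_mul, ← smul_smul, ← hpq, smul_smul, inv_mul_cancel₀ hr0.ne', one_smul]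

end aux

lemma aux_bdd {m : ℕ} {A S : Set (EuclideanSpace ℝ (Fin m))} (hA : A.Finite) (hS : S ⊆ A)
    (r : EuclideanSpace ℝ (Fin m)) :
    BddAbove {c : ℝ | ∃ a ∈ A, ∃ s ∈ S, c = ⟪r, a - s⟫} := by
  have : {c : ℝ | ∃ a ∈ A, ∃ s ∈ S, c = ⟪r, a - s⟫} ⊆
      (fun x : EuclideanSpace ℝ (Fin m) × EuclideanSpace ℝ (Fin m) => ⟪r, x.1 - x.2⟫) ''
        (A ×ˢ S) := by
    rintro c ⟨a, ha, s, hs, rfl⟩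
    exact ⟨(a, s), ⟨ha, hs⟩, rfl⟩
  exact (((hA.prod (hA.subset hS)).image _).subset this).bddAbove

lemma aux_nonneg {m : ℕ} {A S : Set (EuclideanSpace ℝ (Fin m))} (hA : A.Finite) (hS : S ⊆ A)
    {r u : EuclideanSpace ℝ (Fin m)} (hu : u ∈ convexHull ℝ S) :
    0 ≤ sSup {c : ℝ | ∃ a ∈ A, ∃ s ∈ S, c = ⟪r, a - s⟫} := by
  obtain ⟨s, hs⟩ := convexHull_nonempty_iff.1 ⟨u, hu⟩
  exact le_csSup (aux_bdd hA hS r) ⟨s, hS hs, s, hs, by simp⟩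

lemma aux_pdirW_nonneg {m : ℕ} {A : Set (EuclideanSpace ℝ (Fin m))} (hA : A.Finite)
    (r u : EuclideanSpace ℝ (Fin m)) : 0 ≤ pdirW A r u := by
  refine Real.sInf_nonneg ?_
  rintro t ⟨S, hS, hu, rfl⟩
  exact aux_nonneg hA hS hu

lemma aux_pdirW_le {m : ℕ} {A S : Set (EuclideanSpace ℝ (Fin m))} (hA : A.Finite)
    {r u : EuclideanSpace ℝ (Fin m)} (hS : S ⊆ A) (hu : u ∈ convexHull ℝ S) {d : ℝ}
    (h : ∀ a ∈ A, ∀ s ∈ S, ⟪(‖r‖)⁻¹ • r, a - s⟫ ≤ d) : pdirW A r u ≤ d := by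
  have h1 : pdirW A r u ≤ sSup {c | ∃ a ∈ A, ∃ s ∈ S, c = ⟪(‖r‖)⁻¹ • r, a - s⟫} := by
    refine csInf_le ⟨0, ?_⟩ ⟨S, hS, hu, rfl⟩
    rintro t ⟨S, hS, hu, rfl⟩
    exact aux_nonneg hA hS hu
  refine h1.trans (csSup_le ?_ ?_)
  · obtain ⟨s, hs⟩ := convexHull_nonempty_iff.1 ⟨u, hu⟩
    exact ⟨_, s, hS hs, s, hs, rfl⟩
  · rintro c ⟨a, ha, s, hs, rfl⟩
    exact h a ha s hs

lemma aux_face {m : ℕ} {A : Set (EuclideanSpace ℝ (Fin m))} (hA : A.Finite) (n : ℕ) :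
    ∀ E : Set (EuclideanSpace ℝ (Fin m)), (A ∩ E).ncard = n →
    IsExtreme ℝ (convexHull ℝ A) E → Convex ℝ E →
    ∀ p ∈ E, ∀ q ∈ convexHull ℝ (A \ E), ∃ u ∈ convexHull ℝ A, ∃ v ∈ convexHull ℝ A, u ≠ v ∧
      pdirW A (v - u) u ≤ ‖p - q‖ := by
  induction n using Nat.strong_induction_on with
  | _ n ih =>
  intro E hn hE hEc p hp q hq
  have hEeq : E = convexHull ℝ (A ∩ E) :=
    (aux_ext hE).antisymm (convexHull_min Set.inter_subset_right hEc)
  have hEk : IsCompact E := by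
    rw [hEeq]; exact (hA.subset Set.inter_subset_left).isCompact_convexHull ℝ
  have hDk : IsCompact (convexHull ℝ (A \ E)) := (hA.subset Set.sdiff_subset).isCompact_convexHull ℝ
  obtain ⟨⟨x, y⟩, ⟨hx, hy⟩, hmin⟩ := (hEk.prod hDk).exists_isMinOn ⟨(p, q), hp, hq⟩
    (f := fun z => ‖z.1 - z.2‖) (by fun_prop)
  simp only at hx hy
  have hmin' : ∀ x' ∈ E, ∀ y' ∈ convexHull ℝ (A \ E), ‖x - y‖ ≤ ‖x' - y'‖ :=
    fun x' hx' y' hy' => isMinOn_iff.1 hmin (x', y') (Set.mk_mem_prod hx' hy')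
  have hxy : y ≠ x := by
    rintro rfl
    exact (aux_diff hE hy).2 hx
  have n1 : ∀ w ∈ E, ⟪y - x, w - x⟫ ≤ 0 := aux_near hEc hx fun w hw => by
    rw [norm_sub_rev, norm_sub_rev y w]; exact hmin' w hw y hy
  have n2 : ∀ w ∈ convexHull ℝ (A \ E), ⟪x - y, w - y⟫ ≤ 0 :=
    aux_near (convex_convexHull ℝ _) hy fun w hw => hmin' x hx w hw
  let l : EuclideanSpace ℝ (Fin m) →L[ℝ] ℝ := innerSL ℝ (y - x)
  have hl : ∀ z, l z = ⟪y - x, z⟫ := fun z => rfl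
  have hE' : IsExposed ℝ E (l.toExposed E) := ContinuousLinearMap.toExposed.isExposed
  have hxE' : x ∈ l.toExposed E := ⟨hx, fun w hw => by
    have := n1 w hw
    rw [inner_sub_right] at this
    rw [hl, hl]; linarith⟩
  by_cases hall : ∀ a ∈ A ∩ E, a ∈ l.toExposed E
  · refine ⟨y, (aux_diff hE hy).1, x, hE.subset hx, hxy, ?_⟩
    refine le_trans ?_ (hmin' p hp q hq)
    have hne : ‖x - y‖ ≠ 0 := norm_ne_zero_iff.2 (sub_ne_zero.2 hxy.symm)
    have hym := aux_max (innerSL ℝ (x - y)) hy (fun a ha => by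
      have := n2 a (subset_convexHull ℝ _ ha)
      rw [inner_sub_right] at this
      simp only [innerSL_apply_apply]; linarith)
    refine aux_pdirW_le hA (S := _) (fun a ha => ha.1.1) hym ?_
    rintro a ha s ⟨-, hs⟩
    simp only [innerSL_apply_apply] at hs
    have hsq : ⟪x - y, x - y⟫ = ‖x - y‖ * ‖x - y‖ := real_inner_self_eq_norm_mul_norm _
    have hle : ⟪x - y, a - s⟫ ≤ ‖x - y‖ * ‖x - y‖ := by
      rw [inner_sub_right, hs]
      by_cases haE : a ∈ E
      · have h1 := (hall a ⟨ha, haE⟩).2 x hx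
        rw [hl, hl, ← neg_sub x y, inner_neg_left, inner_neg_left] at h1
        rw [inner_sub_right] at hsq
        linarith
      · have := n2 a (subset_convexHull ℝ _ ⟨ha, haE⟩)
        rw [inner_sub_right] at this
        nlinarith [norm_nonneg (x - y)]
    rw [real_inner_smul_left, inv_mul_le_iff₀ (by positivity)]
    exact hle
  · push Not at hall
    obtain ⟨a, ha, ha'⟩ := hall
    have hsub : l.toExposed E ⊆ E := hE'.subset
    have hlt : (A ∩ l.toExposed E).ncard < n := by
      rw [← hn]
      refine Set.ncard_lt_ncard ⟨Set.inter_subset_inter_right _ hsub, fun h => ?_⟩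
        (hA.subset Set.inter_subset_left)
      exact ha' (h ha).2
    obtain ⟨u, hu, v, hv, huv, h⟩ := ih _ hlt _ rfl (hE.trans hE'.isExtreme) (hE'.convex hEc)
      x hxE' y (convexHull_mono (Set.sdiff_subset_sdiff_right hsub) hy)
    exact ⟨u, hu, v, hv, huv, h.trans (hmin' p hp q hq)⟩

/-- The pyramidal width, minimizing over faces `F` of `conv(A)` and pairs `u ≠ v` in `F`,
equals the minimum over pairs `u ≠ v` in `conv(A)` of `PdirW(A, v-u, u)`: the outer
minimization over faces is redundant. -/
theorem pWidth_eq_min_pdirW {m : ℕ} (A : Set (EuclideanSpace ℝ (Fin m)))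
    (hA : A.Finite) (hA2 : ∃ a ∈ A, ∃ b ∈ A, a ≠ b) :
    sInf {t | ∃ F : Set (EuclideanSpace ℝ (Fin m)),
        IsExposed ℝ (convexHull ℝ A) F ∧
        ∃ u ∈ F, ∃ v ∈ F, u ≠ v ∧ t = pdirW (F ∩ A) (v - u) u} =
      sInf {t | ∃ u ∈ convexHull ℝ A, ∃ v ∈ convexHull ℝ A,
        u ≠ v ∧ t = pdirW A (v - u) u} := by
  obtain ⟨a, ha, b, hb, hab⟩ := hA2
  have haC := subset_convexHull ℝ A ha
  have hbC := subset_convexHull ℝ A hb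
  have hCA : convexHull ℝ A ∩ A = A := Set.inter_eq_right.2 (subset_convexHull ℝ A)
  apply le_antisymm
  · refine csInf_le_csInf ⟨0, ?_⟩ ⟨_, a, haC, b, hbC, hab, rfl⟩ ?_
    · rintro t ⟨F, hF, u, hu, v, hv, huv, rfl⟩
      exact aux_pdirW_nonneg (hA.subset Set.inter_subset_right) _ _
    · rintro t ⟨u, hu, v, hv, huv, rfl⟩
      exact ⟨_, IsExposed.refl _, u, hu, v, hv, huv, by rw [hCA]⟩
  · refine le_csInf ⟨_, _, IsExposed.refl _, a, haC, b, hbC, hab, rfl⟩ ?_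
    rintro t ⟨F, hF, u, hu, v, hv, huv, rfl⟩
    have hFc : Convex ℝ F := hF.convex (convex_convexHull ℝ A)
    have hFk : IsCompact F := hF.isCompact (hA.isCompact_convexHull ℝ)
    have hFA := aux_ext hF.isExtreme
    rw [Set.inter_comm] at hFA
    refine le_csInf ⟨_, F ∩ A, subset_rfl, hFA hu, rfl⟩ ?_
    rintro d ⟨S, hS, huS, rfl⟩
    obtain ⟨E, hE, hEc, p, hpF, hpE, q, hqS, hqE, t, ht, hpq⟩ :=
      aux_ray hA hF.isExtreme hFc hFk hS huS hv huv
    obtain ⟨u', hu', v', hv', huv', hle⟩ := aux_face hA _ E rfl hE hEc p hpE q hqE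
    refine le_trans (csInf_le ⟨0, ?_⟩ ⟨u', hu', v', hv', huv', rfl⟩) (hle.trans ?_)
    · rintro t ⟨u, hu, v, hv, huv, rfl⟩
      exact aux_pdirW_nonneg hA _ _
    set r := v - u with hr
    have hr0 : 0 < ‖r‖ := norm_pos_iff.2 (sub_ne_zero.2 huv.symm)
    set D := sSup {c | ∃ a ∈ F ∩ A, ∃ s ∈ S, c = ⟪(‖r‖)⁻¹ • r, a - s⟫} with hD
    have hDle : ∀ a ∈ F ∩ A, ∀ s ∈ S, ⟪(‖r‖)⁻¹ • r, a - s⟫ ≤ D := fun a ha s hs =>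
      le_csSup (aux_bdd (hA.subset Set.inter_subset_right) hS _) ⟨a, ha, s, hs, rfl⟩
    have hlin : IsLinearMap ℝ (fun z : EuclideanSpace ℝ (Fin m) => ⟪(‖r‖)⁻¹ • r, z⟫) :=
      (innerSL ℝ ((‖r‖)⁻¹ • r)).toLinearMap.isLinear
    have h1 : ∀ s ∈ S, ⟪(‖r‖)⁻¹ • r, p⟫ ≤ D + ⟪(‖r‖)⁻¹ • r, s⟫ := by
      intro s hs
      have : convexHull ℝ (F ∩ A) ⊆ {z | ⟪(‖r‖)⁻¹ • r, z⟫ ≤ D + ⟪(‖r‖)⁻¹ • r, s⟫} := by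
        refine convexHull_min (fun a ha => ?_) (convex_halfSpace_le hlin _)
        have := hDle a ha s hs
        rw [inner_sub_right] at this
        simp only [Set.mem_ofPred_eq]; linarith
      exact this (hFA hpF)
    have h2 : ⟪(‖r‖)⁻¹ • r, p⟫ - D ≤ ⟪(‖r‖)⁻¹ • r, q⟫ := by
      have : convexHull ℝ S ⊆ {z | ⟪(‖r‖)⁻¹ • r, p⟫ - D ≤ ⟪(‖r‖)⁻¹ • r, z⟫} := by
        refine convexHull_min (fun s hs => ?_) (convex_halfSpace_ge hlin _)
        have := h1 s hs
        simp only [Set.mem_ofPred_eq]; linarith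
      exact this hqS
    have h3 : ⟪(‖r‖)⁻¹ • r, p - q⟫ = ‖p - q‖ := by
      rw [hpq, real_inner_smul_left, real_inner_smul_right, real_inner_self_eq_norm_mul_norm,
        norm_smul, Real.norm_of_nonneg ht]
      field_simp
    rw [← h3, inner_sub_right]
    linarith
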